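/- Let I ⊆ ℂ[x₀,x₁,x₂] be a Borel-fixed monomial ideal of colength 10 that contains no monomial of degree 1 and contains at least four monomials of degree 2. Then I is not generated by the monomials of degree at most 4 that it contains; equivalently, I has a minimal generator of degree at least 5. (In the paper's terms: no zero-dimensional, saturated, nondegenerate Borel-fixed ideal of degree 10 having at least four quadratic generators is 4-regular.) -/

import Mathlib

open MvPolynomial

/-- `e` is (the exponent vector of) a minimal generator of the ideal `I`. -/
def IsMinGen (I : Ideal (MvPolynomial (Fin 3) ℂ)) (e : Fin 3 →₀ ℕ) : Prop :=
  monomial e (1 : ℂ) ∈ I ∧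
    ∀ t : Fin 3, e t ≠ 0 → monomial (e - Finsupp.single t 1) (1 : ℂ) ∉ I

/-- The exponent vector of the monomial `x₀ᵃ x₁ᵇ x₂ᶜ`. -/
noncomputable def expVec (a b c : ℕ) : Fin 3 →₀ ℕ :=
  Finsupp.equivFunOnFinite.symm ![a, b, c]

@[simp] lemma expVec_zero (a b c : ℕ) : expVec a b c 0 = a := rfl

@[simp] lemma expVec_one (a b c : ℕ) : expVec a b c 1 = b := rfl

@[simp] lemma expVec_two (a b c : ℕ) : expVec a b c 2 = c := rfl

lemma expVec_eta (e : Fin 3 →₀ ℕ) : expVec (e 0) (e 1) (e 2) = e := by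
  ext t; fin_cases t <;> rfl

lemma sum_exponents (e : Fin 3 →₀ ℕ) : (e.sum fun _ n => n) = e 0 + e 1 + e 2 := by
  rw [Finsupp.sum_fintype _ _ (fun _ => rfl), Fin.sum_univ_three]

lemma monomial_mem_of_le {σ R : Type*} [CommSemiring R] {I : Ideal (MvPolynomial σ R)}
    {d e : σ →₀ ℕ} (hde : d ≤ e) (hd : monomial d (1 : R) ∈ I) : monomial e (1 : R) ∈ I := by
  have h := I.mul_mem_left (monomial (e - d) (1 : R)) hd
  rwa [monomial_mul, one_mul, tsub_add_cancel_of_le hde] at h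

lemma expVec_le {a b c a' b' c' : ℕ} (ha : a ≤ a') (hb : b ≤ b') (hc : c ≤ c') :
    expVec a b c ≤ expVec a' b' c' := by
  intro t; fin_cases t <;> assumption

/-- In a Borel-fixed ideal, factors `x₂` may be replaced by `x₁`. -/
lemma borel_shift_two_one {I : Ideal (MvPolynomial (Fin 3) ℂ)}
    (hBorel : ∀ e : Fin 3 →₀ ℕ, monomial e (1 : ℂ) ∈ I →
      ∀ i j : Fin 3, i < j → e j ≠ 0 →
        monomial (e - Finsupp.single j 1 + Finsupp.single i 1) (1 : ℂ) ∈ I)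
    (a b c k : ℕ) (h : monomial (expVec a b (k + c)) (1 : ℂ) ∈ I) :
    monomial (expVec a (b + k) c) (1 : ℂ) ∈ I := by
  induction k generalizing b with
  | zero => simpa using h
  | succ k ih =>
    have h' := hBorel _ h 1 2 (by decide) (by simp)
    have he : expVec a b (k + 1 + c) - Finsupp.single 2 1 + Finsupp.single 1 1 =
        expVec a (b + 1) (k + c) := by
      ext t; fin_cases t <;> simp
    rw [he] at h'
    have := ih (b + 1) h'
    rwa [show b + 1 + k = b + (k + 1) by omega] at this

/-- In a Borel-fixed ideal, factors `x₁` may be replaced by `x₀`. -/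
lemma borel_shift_one_zero {I : Ideal (MvPolynomial (Fin 3) ℂ)}
    (hBorel : ∀ e : Fin 3 →₀ ℕ, monomial e (1 : ℂ) ∈ I →
      ∀ i j : Fin 3, i < j → e j ≠ 0 →
        monomial (e - Finsupp.single j 1 + Finsupp.single i 1) (1 : ℂ) ∈ I)
    (a b c k : ℕ) (h : monomial (expVec a (k + b) c) (1 : ℂ) ∈ I) :
    monomial (expVec (a + k) b c) (1 : ℂ) ∈ I := by
  induction k generalizing a with
  | zero => simpa using h
  | succ k ih =>
    have h' := hBorel _ h 0 1 (by decide) (by simp)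
    have he : expVec a (k + 1 + b) c - Finsupp.single 1 1 + Finsupp.single 0 1 =
        expVec (a + 1) (k + b) c := by
      ext t; fin_cases t <;> simp
    rw [he] at h'
    have := ih (a + 1) h'
    rwa [show a + 1 + k = a + (k + 1) by omega] at this

/-- The exponents of the monomials of degree at most 3 outside `(x₀², x₀x₁, x₀x₂, x₁²)`. -/
def standardExponents : Finset (ℕ × ℕ × ℕ) :=
  {(0, 0, 0), (1, 0, 0), (0, 1, 0), (0, 0, 1), (0, 1, 1), (0, 0, 2), (0, 1, 2), (0, 0, 3)}

lemma mem_standardExponents {a b c : ℕ} (ha : a < 2) (hb : b < 2) (hab : a = 0 ∨ b = 0)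
    (hac : a = 0 ∨ c = 0) (hdeg : a + b + c < 4) : (a, b, c) ∈ standardExponents := by
  have hc : c < 4 := by omega
  interval_cases a <;> interval_cases b <;> interval_cases c <;> first | decide | omega

/-- A Borel-fixed ideal of colength 10 with at least four quadrics does not contain `x₂⁴`. -/
lemma x_two_pow_four_notMem {I : Ideal (MvPolynomial (Fin 3) ℂ)}
    (hBorel : ∀ e : Fin 3 →₀ ℕ, monomial e (1 : ℂ) ∈ I →
      ∀ i j : Fin 3, i < j → e j ≠ 0 →
        monomial (e - Finsupp.single j 1 + Finsupp.single i 1) (1 : ℂ) ∈ I)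
    (hcolen : {e : Fin 3 →₀ ℕ | monomial e (1 : ℂ) ∉ I}.ncard = 10)
    (hdeg2 : 4 ≤ {e : Fin 3 →₀ ℕ |
      (e.sum fun _ n => n) = 2 ∧ monomial e (1 : ℂ) ∈ I}.ncard) :
    monomial (expVec 0 0 4) (1 : ℂ) ∉ I := by
  classical
  intro h4
  have s21 := borel_shift_two_one hBorel
  have s10 := borel_shift_one_zero hBorel
  have quadrics_le (T : Finset (Fin 3 →₀ ℕ)) (hT : T.card ≤ 3)
      (hsub : ∀ a b c : ℕ, a + b + c = 2 → monomial (expVec a b c) (1 : ℂ) ∈ I →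
        expVec a b c ∈ T) : False := by
    have hle := Set.ncard_le_ncard (t := (T : Set (Fin 3 →₀ ℕ))) (fun e he => by
      have := hsub (e 0) (e 1) (e 2) (by rw [← sum_exponents]; exact he.1)
        (by rw [expVec_eta]; exact he.2)
      rwa [expVec_eta] at this) T.finite_toSet |> hdeg2.trans
    rw [Set.ncard_coe_finset] at hle
    omega
  have h020 : monomial (expVec 0 2 0) (1 : ℂ) ∈ I := by
    by_contra hn
    have h011 : monomial (expVec 0 1 1) (1 : ℂ) ∉ I := fun h => hn (s21 0 1 0 1 h)
    have h002 : monomial (expVec 0 0 2) (1 : ℂ) ∉ I := fun h => h011 (s21 0 0 1 1 h)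
    refine quadrics_le {expVec 2 0 0, expVec 1 1 0, expVec 1 0 1} Finset.card_le_three ?_
    intro a b c habc h
    have ha : a ≤ 2 := by omega
    have hb : b ≤ 2 := by omega
    obtain rfl : c = 2 - a - b := by omega
    interval_cases a <;> interval_cases b <;> simp_all
  have h101 : monomial (expVec 1 0 1) (1 : ℂ) ∈ I := by
    by_contra hn
    have h011 : monomial (expVec 0 1 1) (1 : ℂ) ∉ I := fun h => hn (s10 0 0 1 1 h)
    have h002 : monomial (expVec 0 0 2) (1 : ℂ) ∉ I := fun h => h011 (s21 0 0 1 1 h)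
    refine quadrics_le {expVec 2 0 0, expVec 1 1 0, expVec 0 2 0} Finset.card_le_three ?_
    intro a b c habc h
    have ha : a ≤ 2 := by omega
    have hb : b ≤ 2 := by omega
    obtain rfl : c = 2 - a - b := by omega
    interval_cases a <;> interval_cases b <;> simp_all
  have h110 : monomial (expVec 1 1 0) (1 : ℂ) ∈ I := s10 0 1 0 1 h020
  have h200 : monomial (expVec 2 0 0) (1 : ℂ) ∈ I := s10 1 0 0 1 h110
  have hsub : {e : Fin 3 →₀ ℕ | monomial e (1 : ℂ) ∉ I} ⊆
      (standardExponents.image fun p => expVec p.1 p.2.1 p.2.2 : Finset (Fin 3 →₀ ℕ)) := by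
    intro e he
    rw [Set.mem_ofPred_eq, ← expVec_eta e] at he
    rw [← expVec_eta e, Finset.mem_coe]
    refine Finset.mem_image_of_mem (fun p : ℕ × ℕ × ℕ => expVec p.1 p.2.1 p.2.2)
      (a := (e 0, e 1, e 2)) ?_
    generalize e 0 = a at he ⊢
    generalize e 1 = b at he ⊢
    generalize e 2 = c at he ⊢
    have not_le {a' b' c' : ℕ} (h : monomial (expVec a' b' c') (1 : ℂ) ∈ I) :
        ¬ (a' ≤ a ∧ b' ≤ b ∧ c' ≤ c) :=
      fun hle => he (monomial_mem_of_le (expVec_le hle.1 hle.2.1 hle.2.2) h)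
    have n1 := not_le h020
    have n2 := not_le h101
    have n3 := not_le h110
    have n4 := not_le h200
    have hdeg : a + b + c < 4 := by
      by_contra! hge
      have h := monomial_mem_of_le (expVec_le le_rfl le_rfl hge) h4
      have h' := s10 0 b c a (by simpa using s21 0 0 c (a + b) h)
      exact he (by simpa using h')
    exact mem_standardExponents (by omega) (by omega) (by omega) (by omega) hdeg
  have hle := Set.ncard_le_ncard hsub (Finset.finite_toSet _)
  rw [hcolen, Set.ncard_coe_finset] at hle
  have : standardExponents.card = 8 := rfl
  have := hle.trans Finset.card_image_le
  omega

/-- Let `I ⊆ ℂ[x₀,x₁,x₂]` be a Borel-fixed monomial ideal of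
colength 10 containing no monomial of degree 1 and at least four monomials of
degree 2.  Then `I` is not generated by the monomials of degree at most 4 that it
contains; equivalently, `I` has a minimal generator of degree at least 5. -/
theorem stmt_7 (I : Ideal (MvPolynomial (Fin 3) ℂ))
    (G : Set (Fin 3 →₀ ℕ))
    (hI : I = Ideal.span ((fun e => monomial e (1 : ℂ)) '' G))
    (hBorel : ∀ e : Fin 3 →₀ ℕ, monomial e (1 : ℂ) ∈ I →
      ∀ i j : Fin 3, i < j → e j ≠ 0 →
        monomial (e - Finsupp.single j 1 + Finsupp.single i 1) (1 : ℂ) ∈ I)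
    (hcolen : {e : Fin 3 →₀ ℕ | monomial e (1 : ℂ) ∉ I}.ncard = 10)
    (hdeg1 : ∀ e : Fin 3 →₀ ℕ, (e.sum fun _ n => n) = 1 → monomial e (1 : ℂ) ∉ I)
    (hdeg2 : 4 ≤ {e : Fin 3 →₀ ℕ |
      (e.sum fun _ n => n) = 2 ∧ monomial e (1 : ℂ) ∈ I}.ncard) :
    I ≠ Ideal.span
        ((fun e => monomial e (1 : ℂ)) ''
          {e : Fin 3 →₀ ℕ | (e.sum fun _ n => n) ≤ 4 ∧ monomial e (1 : ℂ) ∈ I}) ∧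
      ∃ e : Fin 3 →₀ ℕ, IsMinGen I e ∧ 5 ≤ (e.sum fun _ n => n) := by
  have h4 := x_two_pow_four_notMem hBorel hcolen hdeg2
  have hfin : {e : Fin 3 →₀ ℕ | monomial e (1 : ℂ) ∉ I}.Finite :=
    Set.finite_of_ncard_ne_zero (by omega)
  have hex : ∃ k, monomial (expVec 0 0 k) (1 : ℂ) ∈ I := by
    by_contra! hn
    refine Set.infinite_of_injective_forall_mem (f := expVec 0 0) (fun k l hkl => ?_) hn hfin
    simpa using DFunLike.congr_fun hkl 2
  classical
  obtain ⟨k, hk, hmin⟩ : ∃ k, monomial (expVec 0 0 k) (1 : ℂ) ∈ I ∧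
      ∀ l < k, monomial (expVec 0 0 l) (1 : ℂ) ∉ I :=
    ⟨Nat.find hex, Nat.find_spec hex, fun _ hl => Nat.find_min hex hl⟩
  have hk5 : 5 ≤ k := by
    by_contra! hlt
    exact h4 (monomial_mem_of_le (expVec_le le_rfl le_rfl (by omega)) hk)
  refine ⟨fun heq => ?_, expVec 0 0 k, ⟨hk, fun t ht => ?_⟩, by simpa [sum_exponents] using hk5⟩
  · have hk' := hk
    rw [heq, mem_ideal_span_monomial_image] at hk'
    obtain ⟨e, ⟨hdeg, he⟩, hle⟩ := hk' (expVec 0 0 k) (by simp [mem_support_iff])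
    rw [sum_exponents] at hdeg
    have h0 : e 0 ≤ 0 := hle 0
    have h1 : e 1 ≤ 0 := hle 1
    rw [← expVec_eta e] at he
    exact h4 (monomial_mem_of_le (expVec_le h0 h1 (by omega)) he)
  · have he : expVec 0 0 k - Finsupp.single 2 1 = expVec 0 0 (k - 1) := by
      ext t; fin_cases t <;> simp
    fin_cases t
    · simp at ht
    · simp at ht
    · exact he ▸ hmin (k - 1) (by omega)
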